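/- arXiv:1710.02407 — 2 statements merged into one kernel-verified Lean document; each statement's English description precedes it below -/
import Mathlib

section
/- The vector X itself satisfies F(X) = 1, and g_X([X,Z]_𝔪, X) = 0 for every Z ∈ 𝔪 if and only if ⟨[X,Z]_𝔪, X⟩ = 0 for every Z ∈ 𝔪. (That is, X is a geodesic vector of the Kropina metric if and only if it is a geodesic vector of the underlying Riemannian metric.) -/
open RealInnerProductSpace

theorem hasFDerivAt_real_inner_self {E : Type*} [NormedAddCommGroup E]
    [InnerProductSpace ℝ E] (y : E) :
    HasFDerivAt (fun z : E => ⟪z, z⟫) ((2 : ℝ) • innerSL ℝ y) y := by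
  refine ((hasFDerivAt_id y).inner ℝ (hasFDerivAt_id y)).congr_fderiv ?_
  ext u
  simp [real_inner_comm, two_mul]

theorem hasFDerivAt_inner_pow_inv {E : Type*} [NormedAddCommGroup E]
    [InnerProductSpace ℝ E] (X y : E) (hy : ⟪X, y⟫ ≠ 0) (n : ℕ) :
    HasFDerivAt (fun z : E => (⟪X, z⟫ ^ n)⁻¹)
      ((-((⟪X, y⟫ ^ n) ^ 2)⁻¹) • (n • ⟪X, y⟫ ^ (n - 1)) • innerSL ℝ X) y := by
  have hL : HasFDerivAt (fun z : E => ⟪X, z⟫) (innerSL ℝ X) y := (innerSL ℝ X).hasFDerivAt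
  exact HasDerivAt.comp_hasFDerivAt (h₂ := fun r : ℝ => r⁻¹) (f := fun z : E => ⟪X, z⟫ ^ n) y
    (hasDerivAt_inv (pow_ne_zero n hy)) (hL.pow n)

/-- The first derivative of the square of the Kropina function. -/
theorem hasFDerivAt_kropina_sq {E : Type*} [NormedAddCommGroup E]
    [InnerProductSpace ℝ E] (X y : E) (hy : ⟪X, y⟫ ≠ 0) :
    HasFDerivAt (fun z : E => (⟪z, z⟫ / ⟪X, z⟫) ^ 2)
      ((4 * ⟪y, y⟫ * (⟪X, y⟫ ^ 2)⁻¹) • innerSL ℝ y -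
        (2 * ⟪y, y⟫ ^ 2 * (⟪X, y⟫ ^ 3)⁻¹) • innerSL ℝ X) y := by
  have hN := hasFDerivAt_real_inner_self y
  have h2 := hasFDerivAt_inner_pow_inv X y hy 2
  have hD := HasFDerivAt.mul (hN.pow 2) h2
  simp only [div_eq_mul_inv, mul_pow, inv_pow]
  refine hD.congr_fderiv ?_
  ext u
  simp
  field_simp
  ring

/-- The fundamental tensor of the Kropina function at its defining vector `X`, with `X` in the
second slot: by homogeneity it is proportional to the inner product with `X`. -/
theorem fderiv_fderiv_kropina_sq_apply_self {E : Type*} [NormedAddCommGroup E]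
    [InnerProductSpace ℝ E] (X : E) (hX : X ≠ 0) (F : E → ℝ)
    (hF : ∀ y : E, ⟪X, y⟫ ≠ 0 → F y = ⟪y, y⟫ / ⟪X, y⟫) (u : E) :
    fderiv ℝ (fun z => fderiv ℝ (fun w => F w ^ 2) z) X u X = 2 * ⟪u, X⟫ / ⟪X, X⟫ := by
  have hs : ⟪X, X⟫ ≠ 0 := inner_self_ne_zero.mpr hX
  have hL : HasFDerivAt (fun z : E => ⟪X, z⟫) (innerSL ℝ X) X := (innerSL ℝ X).hasFDerivAt
  have hN := hasFDerivAt_real_inner_self X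
  obtain ⟨J, hJ, hI⟩ : ∃ J : E →L[ℝ] E →L[ℝ] ℝ, (∀ u, J u X = ⟪X, u⟫) ∧
      HasFDerivAt (fun z : E => innerSL ℝ z) J X :=
    ⟨innerSL ℝ, fun u => real_inner_comm X u, (innerSL ℝ (E := E)).hasFDerivAt⟩
  have hne : ∀ᶠ z in nhds X, ⟪X, z⟫ ≠ 0 := hL.continuousAt.eventually_ne hs
  have heq : (fun z => fderiv ℝ (fun w => F w ^ 2) z) =ᶠ[nhds X] fun y =>
      (4 * ⟪y, y⟫ * (⟪X, y⟫ ^ 2)⁻¹) • innerSL ℝ y -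
        (2 * ⟪y, y⟫ ^ 2 * (⟪X, y⟫ ^ 3)⁻¹) • innerSL ℝ X := by
    filter_upwards [hne.eventually_nhds] with z hz
    have hFz : (fun w => F w ^ 2) =ᶠ[nhds z] fun w => (⟪w, w⟫ / ⟪X, w⟫) ^ 2 := by
      filter_upwards [hz] with w hw
      rw [hF w hw]
    exact ((hasFDerivAt_kropina_sq X z hz.self_of_nhds).congr_of_eventuallyEq hFz).fderiv
  have h2 := hasFDerivAt_inner_pow_inv X X hs 2
  have h3 := hasFDerivAt_inner_pow_inv X X hs 3
  have hD := (HasFDerivAt.smul (HasFDerivAt.mul (hN.const_mul 4) h2) hI).sub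
    ((HasFDerivAt.mul ((hN.pow 2).const_mul 2) h3).smul_const (innerSL ℝ X))
  have hD' := (hD.congr_of_eventuallyEq heq).fderiv
  rw [hD']
  simp only [real_inner_comm X u, sub_apply, add_apply,
    smul_apply, ContinuousLinearMap.smulRight_apply, innerSL_apply_apply,
    smul_eq_mul, nsmul_eq_mul, Pi.mul_apply, hJ]
  field_simp
  push_cast
  ring

/-- In the homogeneous Kropina setting, the vector `X` itself satisfies
`F(X) = 1`, and `g_X([X,Z]_𝔪, X) = 0` for every `Z ∈ 𝔪` iff `⟪[X,Z]_𝔪, X⟫ = 0` for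
every `Z ∈ 𝔪` (i.e. `X` is a geodesic vector of the Kropina metric iff it is a geodesic
vector of the underlying Riemannian metric). -/
theorem kropina_X_geodesic_iff_riemannian_geodesic
    {G : Type*} [NormedAddCommGroup G] [InnerProductSpace ℝ G] [FiniteDimensional ℝ G]
    (bracket : G →ₗ[ℝ] G →ₗ[ℝ] G)
    (hanti : ∀ x : G, bracket x x = 0)
    (hjacobi : ∀ x y z : G,
      bracket x (bracket y z) + bracket y (bracket z x) + bracket z (bracket x y) = 0)
    (H m : Submodule ℝ G)
    (hHsub : ∀ x ∈ H, ∀ y ∈ H, bracket x y ∈ H)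
    (hcompl : IsCompl m H)
    (π : G →ₗ[ℝ] G) (hπm : ∀ w : G, π w ∈ m) (hπH : ∀ w : G, w - π w ∈ H)
    (X : G) (hXm : X ∈ m) (hX0 : X ≠ 0)
    (F : G → ℝ) (hF : ∀ y : G, ⟪X, y⟫ ≠ 0 → F y = ⟪y, y⟫ / ⟪X, y⟫) :
    F X = 1 ∧
    ((∀ Z ∈ m, (1 / 2 : ℝ) *
        fderiv ℝ (fun z => fderiv ℝ (fun w => F w ^ 2) z) X (π (bracket X Z)) X = 0)
      ↔ (∀ Z ∈ m, ⟪π (bracket X Z), X⟫ = 0)) := by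
  have hs : ⟪X, X⟫ ≠ 0 := inner_self_ne_zero.mpr hX0
  refine ⟨by rw [hF X hs, div_self hs], forall₂_congr fun Z _ => ?_⟩
  rw [fderiv_fderiv_kropina_sq_apply_self X hX0 F hF]
  simp [hX0]
end

section
/- For every y ∈ V with y ≠ 0, every u ∈ V, and r = ⟨X,y⟩/‖y‖, the fundamental tensor of the (α,β)-function satisfies g_y(u, y) = F(y) · [ (φ(r) − r·φ′(r)) · ⟨u,y⟩/‖y‖ + φ′(r) · ⟨X,u⟩ ]. -/
open RealInnerProductSpace

/-- Away from the origin, the norm of a real inner product space has derivative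
`u ↦ ⟪y, u⟫ / ‖y‖`. -/
theorem hasFDerivAt_norm_of_ne_zero {V : Type*} [NormedAddCommGroup V] [InnerProductSpace ℝ V]
    {y : V} (hy : y ≠ 0) :
    HasFDerivAt (fun z : V => ‖z‖) (‖y‖⁻¹ • innerSL ℝ y) y := by
  have hn : ‖y‖ ≠ 0 := norm_ne_zero_iff.mpr hy
  have h := (hasStrictFDerivAt_norm_sq y).hasFDerivAt.sqrt (pow_ne_zero 2 hn)
  simp only [Real.sqrt_sq (norm_nonneg _)] at h
  refine h.congr_fderiv ?_
  ext u
  simp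
  field_simp

/-- If `D G(z) z = k • G(z)` near `y` and `G` is twice differentiable at `y`, then
`D²G(y)[u, y] = (k - 1) • DG(y) u`. -/
theorem fderiv_fderiv_apply_self_of_euler {V W : Type*} [NormedAddCommGroup V] [NormedSpace ℝ V]
    [NormedAddCommGroup W] [NormedSpace ℝ W] {G : V → W} {y : V} {k : ℝ}
    (hG : ContDiffAt ℝ 2 G y) (hE : ∀ᶠ z in nhds y, fderiv ℝ G z z = k • G z) (u : V) :
    fderiv ℝ (fun z => fderiv ℝ G z) y u y = (k - 1) • fderiv ℝ G y u := by
  have hd : DifferentiableAt ℝ (fderiv ℝ G) y :=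
    (hG.fderiv_right (m := 1) (by norm_num)).differentiableAt one_ne_zero
  have h₁ := hd.hasFDerivAt.clm_apply (hasFDerivAt_id y)
  have h₂ := (hG.differentiableAt two_ne_zero).hasFDerivAt.const_smul k
  have h := congrArg (fun L : V →L[ℝ] W => L u) (h₁.unique (h₂.congr_of_eventuallyEq hE))
  simp at h
  rw [sub_smul, one_smul, ← h]
  abel

/-- The derivative of the (α,β)-function `z ↦ ‖z‖ · φ(⟪X, z⟫/‖z‖)` away from the origin. -/
theorem hasFDerivAt_norm_mul_comp_inner_div_norm {V : Type*} [NormedAddCommGroup V]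
    [InnerProductSpace ℝ V] (X : V) {φ : ℝ → ℝ} {y : V} (hy : y ≠ 0)
    (hφ : DifferentiableAt ℝ φ (⟪X, y⟫ / ‖y‖)) :
    HasFDerivAt (fun z : V => ‖z‖ * φ (⟪X, z⟫ / ‖z‖))
      (((φ (⟪X, y⟫ / ‖y‖) - (⟪X, y⟫ / ‖y‖) * deriv φ (⟪X, y⟫ / ‖y‖)) * ‖y‖⁻¹) • innerSL ℝ y
        + deriv φ (⟪X, y⟫ / ‖y‖) • innerSL ℝ X) y := by
  have hn : ‖y‖ ≠ 0 := norm_ne_zero_iff.mpr hy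
  have hN := hasFDerivAt_norm_of_ne_zero hy
  have hX : HasFDerivAt (fun z : V => ⟪X, z⟫) (innerSL ℝ X) y := (innerSL ℝ X).hasFDerivAt
  have hr := hX.mul ((hasDerivAt_inv hn).comp_hasFDerivAt y hN)
  have h := hN.mul (hφ.hasDerivAt.comp_hasFDerivAt y hr)
  refine h.congr_fderiv ?_
  ext u
  simp [← div_eq_mul_inv]
  field_simp
  ring

/-- For the (α,β)-function `F y = ‖y‖ · φ(⟪X, y⟫/‖y‖)` with `φ` smooth,
for every `y ≠ 0`, every `u`, and `r = ⟪X, y⟫/‖y‖`, the fundamental tensor satisfies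
`g_y(u, y) = F(y) · [(φ(r) − r·φ′(r))·⟪u, y⟫/‖y‖ + φ′(r)·⟪X, u⟫]`, where
`g_y(u, v) = (1/2)·D²(F²)(y)[u, v]`. -/
theorem alpha_beta_fundamental_tensor_identity
    {V : Type*} [NormedAddCommGroup V] [InnerProductSpace ℝ V] [FiniteDimensional ℝ V]
    (X : V) (φ : ℝ → ℝ) (hφ : ContDiff ℝ (⊤ : ℕ∞) φ)
    (F : V → ℝ) (hF : ∀ y : V, y ≠ 0 → F y = ‖y‖ * φ (⟪X, y⟫ / ‖y‖))
    (y : V) (hy : y ≠ 0) (u : V) :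
    (1 / 2 : ℝ) * fderiv ℝ (fun z => fderiv ℝ (fun w => F w ^ 2) z) y u y
      = F y * ((φ (⟪X, y⟫ / ‖y‖) - (⟪X, y⟫ / ‖y‖) * deriv φ (⟪X, y⟫ / ‖y‖)) *
            (⟪u, y⟫ / ‖y‖)
          + deriv φ (⟪X, y⟫ / ‖y‖) * ⟪X, u⟫) := by
  have hφd : Differentiable ℝ φ := hφ.differentiable (by simp)
  have hnhds : ∀ z : V, z ≠ 0 → F =ᶠ[nhds z] fun w => ‖w‖ * φ (⟪X, w⟫ / ‖w‖) := fun z hz => by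
    filter_upwards [isOpen_ne.mem_nhds hz] with w hw using hF w hw
  have hD := fun (z : V) (hz : z ≠ 0) =>
    ((hasFDerivAt_norm_mul_comp_inner_div_norm X hz (hφd _)).congr_of_eventuallyEq
      (hnhds z hz)).pow 2
  have hsmooth : ContDiffAt ℝ 2 (fun w => F w ^ 2) y := by
    have hN : ContDiffAt ℝ 2 (fun w : V => ‖w‖) y := contDiffAt_norm ℝ hy
    have hr : ContDiffAt ℝ 2 (fun w : V => ⟪X, w⟫ / ‖w‖) y :=
      (contDiffAt_const.inner ℝ contDiffAt_id).div hN (norm_ne_zero_iff.mpr hy)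
    have hφ₂ : ContDiff ℝ 2 φ := contDiff_infty.mp hφ 2
    exact ((hN.mul (hφ₂.contDiffAt.comp y hr)).congr_of_eventuallyEq (hnhds y hy)).pow 2
  have hE : ∀ᶠ z in nhds y, fderiv ℝ (fun w => F w ^ 2) z z = (2 : ℝ) • F z ^ 2 := by
    filter_upwards [isOpen_ne.mem_nhds hy] with z hz
    have hn : ‖z‖ ≠ 0 := norm_ne_zero_iff.mpr hz
    rw [(hD z hz).fderiv]
    simp [hF z hz]
    field_simp
    ring
  rw [fderiv_fderiv_apply_self_of_euler hsmooth hE, (hD y hy).fderiv]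
  simp [real_inner_comm]
  ring
end
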